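/- Let X be a finite uniform d-dimensional simplicial complex with d ≥ 2, and let p = (d−1)/(3d−1). Then the following are equivalent: (i) for every oriented (d−1)-cell σ, the normalized expectation process Ẽ_n^σ of the p-lazy (d−1)-walk started at σ converges as n → ∞ and its limit is exact; (ii) H_{d−1}(X;ℝ) = 0 and no (d−1)-component of X is disorientable. -/

import Mathlib

open scoped BigOperators Classical
open Filter Topology

noncomputable section

/-- A simplicial complex on a vertex set `V`: a family of finite subsets of `V`
(the cells) closed under taking nonempty subsets. -/
structure SComplex (V : Type*) where
  cells : Set (Finset V)
  down_closed : ∀ ⦃s t : Finset V⦄, s ∈ cells → t ⊆ s → t.Nonempty → t ∈ cells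

namespace SComplex

variable {V : Type*} (X : SComplex V)

/-- The tuple `σ` of `n` vertices spans an `(n-1)`-dimensional cell of `X`. -/
def IsCellT {n : ℕ} (σ : Fin n → V) : Prop :=
  Function.Injective σ ∧ Finset.image σ Finset.univ ∈ X.cells

/-- The degree of a cell `s`: the number of cells with one more vertex containing it. -/
def degS (s : Finset V) : ℕ :=
  Set.ncard {t : Finset V | t ∈ X.cells ∧ t.card = s.card + 1 ∧ s ⊆ t}

/-- Degree of the cell spanned by a tuple. -/
def degT {n : ℕ} (σ : Fin n → V) : ℕ :=
  X.degS (Finset.image σ Finset.univ)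

/-- An `(n-1)`-form: an alternating function on oriented `(n-1)`-cells, encoded as a
function on `n`-tuples of vertices which vanishes off the cells of `X` and is
antisymmetric under permutations. -/
def IsForm (n : ℕ) (f : (Fin n → V) → ℝ) : Prop :=
  (∀ σ, ¬ X.IsCellT σ → f σ = 0) ∧
  ∀ (σ : Fin n → V) (π : Equiv.Perm (Fin n)),
    f (σ ∘ π) = ((Equiv.Perm.sign π : ℤ) : ℝ) * f σ

/-- The Dirac form `𝟙_{σ₀}`: 1 at `σ₀`, -1 at the reversed orientation, 0 elsewhere. -/
def dirac {n : ℕ} (σ₀ : Fin n → V) : (Fin n → V) → ℝ := fun σ =>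
  if ∃ π : Equiv.Perm (Fin n), Equiv.Perm.sign π = 1 ∧ σ = σ₀ ∘ π then 1
  else if ∃ π : Equiv.Perm (Fin n), Equiv.Perm.sign π = -1 ∧ σ = σ₀ ∘ π then -1
  else 0

/-- The boundary operator: `(∂f)(σ) = Σ_{v : vσ ∈ X} f(vσ)`. -/
def bdry {n : ℕ} (f : (Fin (n + 1) → V) → ℝ) : (Fin n → V) → ℝ := fun σ =>
  ∑ᶠ v ∈ {v : V | X.IsCellT (Fin.cons v σ)}, f (Fin.cons v σ)

/-- The weighted sum of `f` over the neighbours of `σ`: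
`Σ_{σ' ∼ σ} f(σ')/deg σ' = Σ_{v ◁ σ} Σ_i (-1)^i f(v(σ∖σ_i))/deg(v(σ∖σ_i))`. -/
def nbrW {n : ℕ} (f : (Fin (n + 1) → V) → ℝ) : (Fin (n + 1) → V) → ℝ := fun σ =>
  ∑ᶠ v ∈ {v : V | X.IsCellT (Fin.cons v σ)},
    ∑ i : Fin (n + 1),
      (-1 : ℝ) ^ (i : ℕ) * f (Fin.cons v (σ ∘ i.succAbove)) /
        (X.degT (Fin.cons v (σ ∘ i.succAbove)) : ℝ)

/-- The unweighted sum of `f` over the neighbours of `σ`: `Σ_{σ' ∼ σ} f(σ')`. -/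
def nbrU {n : ℕ} (f : (Fin (n + 1) → V) → ℝ) : (Fin (n + 1) → V) → ℝ := fun σ =>
  ∑ᶠ v ∈ {v : V | X.IsCellT (Fin.cons v σ)},
    ∑ i : Fin (n + 1), (-1 : ℝ) ^ (i : ℕ) * f (Fin.cons v (σ ∘ i.succAbove))

/-- The upper Laplacian `(Δ⁺f)(σ) = f(σ) - Σ_{σ'∼σ} f(σ')/deg σ'`. -/
def lapUp {n : ℕ} (f : (Fin (n + 1) → V) → ℝ) : (Fin (n + 1) → V) → ℝ := fun σ =>
  f σ - X.nbrW f σ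

/-- The transition operator of the `p`-lazy walk:
`(Af)(σ) = p f(σ) + ((1-p)/d) Σ_{σ'∼σ} f(σ')/deg σ'`, where `d = n+1`. -/
def transOp {n : ℕ} (p : ℝ) (f : (Fin (n + 1) → V) → ℝ) : (Fin (n + 1) → V) → ℝ := fun σ =>
  p * f σ + ((1 - p) / ((n : ℝ) + 1)) * X.nbrW f σ

/-- The normalized expectation process `Ẽ_nn = (d/(p(d-1)+1))^nn • A^nn 𝟙_{σ₀}`. -/
def nexp {n : ℕ} (p : ℝ) (σ₀ : Fin (n + 1) → V) (nn : ℕ) : (Fin (n + 1) → V) → ℝ :=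
  (((n : ℝ) + 1) / (p * (n : ℝ) + 1)) ^ nn • (X.transOp p)^[nn] (SComplex.dirac σ₀)

/-- The weighted inner product `⟨f,g⟩ = Σ_{σ ∈ X^{n-1}} f(σ)g(σ)/deg σ`
(each unoriented cell is represented by `n!` tuples). -/
def innerW [Fintype V] {n : ℕ} (f g : (Fin n → V) → ℝ) : ℝ :=
  (1 / (n.factorial : ℝ)) * ∑ σ : Fin n → V, f σ * g σ / (X.degT σ : ℝ)

/-- The unweighted inner product `⟨f,g⟩ = Σ_{σ ∈ X^{n-1}} f(σ)g(σ)`. -/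
def innerU [Fintype V] {n : ℕ} (f g : (Fin n → V) → ℝ) : ℝ :=
  (1 / (n.factorial : ℝ)) * ∑ σ : Fin n → V, f σ * g σ

/-- The norm induced by the weighted inner product. -/
def normW [Fintype V] {n : ℕ} (f : (Fin n → V) → ℝ) : ℝ :=
  Real.sqrt (X.innerW f f)

/-- `f` is a closed `(d-1)`-form (`f ∈ Z^{d-1} = ker ∂_d^*`), characterized by
orthogonality to the image of `∂_d`. -/
def IsClosedForm [Fintype V] (m : ℕ) (f : (Fin (m + 2) → V) → ℝ) : Prop :=
  X.IsForm (m + 2) f ∧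
  ∀ g : (Fin (m + 3) → V) → ℝ, X.IsForm (m + 3) g → X.innerW f (X.bdry g) = 0

/-- `f` is an exact `(d-1)`-form (`f ∈ B^{d-1} = im ∂_{d-1}^*`): `f = ∂_{d-1}^* g` for a
`(d-2)`-form `g`, characterized by the adjoint identity. -/
def IsExactForm [Fintype V] (m : ℕ) (f : (Fin (m + 2) → V) → ℝ) : Prop :=
  X.IsForm (m + 2) f ∧
  ∃ g : (Fin (m + 1) → V) → ℝ, X.IsForm (m + 1) g ∧
    ∀ h : (Fin (m + 2) → V) → ℝ, X.IsForm (m + 2) h →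
      X.innerW f h = innerU g (X.bdry h)

/-- Two tuples span the same oriented cell. -/
def SameOr {n : ℕ} (σ σ' : Fin n → V) : Prop :=
  ∃ π : Equiv.Perm (Fin n), Equiv.Perm.sign π = 1 ∧ σ' = σ ∘ π

/-- The neighbour relation on oriented `(d-1)`-cells: `σ ∼ σ'` iff there is an oriented
`d`-cell of which both `σ` and the reversal of `σ'` are faces with the induced
orientation; equivalently `σ' = (-1)^i v(σ∖σ_i)` for some `v ◁ σ`. -/
def Nbr {n : ℕ} (σ σ' : Fin (n + 1) → V) : Prop :=
  ∃ (v : V) (i : Fin (n + 1)), X.IsCellT (Fin.cons v σ) ∧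
    (if Even (i : ℕ) then SameOr σ' (Fin.cons v (σ ∘ i.succAbove))
     else SameOr σ' (Fin.cons v (σ ∘ i.succAbove) ∘ Equiv.swap 0 1))

/-- `σ` is a face of the oriented cell `τ` with the orientation induced by `τ`. -/
def IsInducedFace {n : ℕ} (σ : Fin (n + 1) → V) (τ : Fin (n + 2) → V) : Prop :=
  ∃ i : Fin (n + 2), if Even (i : ℕ) then SameOr σ (τ ∘ i.succAbove)
    else SameOr σ (τ ∘ i.succAbove ∘ Equiv.swap 0 1)

/-- The family `𝒯` of `d`-cells (`d = m+2`) admits a disorientation: a choice of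
orientation for each cell of `𝒯` such that any two of them sharing a
codimension-one face induce the same orientation on it. -/
def HasDisorientation (m : ℕ) (𝒯 : Set (Finset V)) : Prop :=
  ∃ c : Finset V → (Fin (m + 3) → V),
    (∀ t ∈ 𝒯, Function.Injective (c t) ∧ Finset.image (c t) Finset.univ = t) ∧
    ∀ t ∈ 𝒯, ∀ t' ∈ 𝒯, t ≠ t' → (t ∩ t').card = m + 2 →
      ∃ σ : Fin (m + 2) → V, Function.Injective σ ∧
        Finset.image σ Finset.univ = t ∩ t' ∧
        IsInducedFace σ (c t) ∧ IsInducedFace σ (c t')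

/-- `X` (of dimension `d`) has no simple `d`-loops: no non-backtracking closed chain
of `d`-cells in which consecutive cells share a `(d-1)`-cell. -/
def NoSimpleLoops (d : ℕ) : Prop :=
  ∀ (n : ℕ) (τ : ℕ → Finset V), 2 ≤ n → (∀ i, τ (i + n) = τ i) →
    (∀ i, τ i ∈ X.cells ∧ (τ i).card = d + 1) →
    (∀ i, (τ i ∩ τ (i + 1)) ∈ X.cells ∧ (τ i ∩ τ (i + 1)).card = d) →
    (∀ i, τ i ≠ τ (i + 2)) → False

end SComplex

open SComplex

/-- The iterates of an endomorphism that is symmetric for a positive definite form, and whose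
quadratic form lies in `(-1, 1]`, converge weakly to a fixed point of the endomorphism. -/
lemma exists_fixed_tendsto_pow {M : Type*} [AddCommGroup M] [Module ℝ M] [FiniteDimensional ℝ M]
    (B : M →ₗ[ℝ] M →ₗ[ℝ] ℝ) (hsymm : ∀ x y, B x y = B y x) (hpos : ∀ x, x ≠ 0 → 0 < B x x)
    (T : M →ₗ[ℝ] M) (hT : ∀ x y, B (T x) y = B x (T y))
    (hupper : ∀ x, B (T x) x ≤ B x x) (hlower : ∀ x, x ≠ 0 → -B x x < B (T x) x) (x : M) :
    ∃ L, T L = L ∧ ∀ φ : M →ₗ[ℝ] ℝ, Tendsto (fun n => φ ((T ^ n) x)) atTop (𝓝 (φ L)) := by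
  let core : InnerProductSpace.Core ℝ M :=
    { inner := fun x y => B x y
      conj_inner_symm := fun x y => by simp [hsymm x y]
      re_inner_nonneg := fun x => by
        rcases eq_or_ne x 0 with rfl | hx
        · simp
        · simpa using (hpos x hx).le
      add_left := fun x y z => by simp
      smul_left := fun x y r => by simp
      definite := fun x hx => by
        by_contra h
        exact (hpos x h).ne' hx }
  let _ : NormedAddCommGroup M := core.toNormedAddCommGroup
  let _ : InnerProductSpace ℝ M := InnerProductSpace.ofCore core.toCore
  have hS : T.IsSymmetric := fun x y => hT x y
  let b := hS.eigenvectorBasis rfl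
  let ev := hS.eigenvalues rfl
  have hb : ∀ i, T (b i) = ev i • b i := fun i => hS.apply_eigenvectorBasis rfl i
  have hev : ∀ i, -1 < ev i ∧ ev i ≤ 1 := fun i => by
    have h0 : b i ≠ 0 := b.orthonormal.ne_zero i
    have hp := hpos _ h0
    have hu := hupper (b i)
    have hl := hlower _ h0
    rw [hb, map_smul, LinearMap.smul_apply, smul_eq_mul] at hu hl
    constructor <;> nlinarith
  have hpow : ∀ n i, (T ^ n) (b i) = ev i ^ n • b i := fun n i => by
    induction n with
    | zero => simp
    | succ n ih => rw [pow_succ', Module.End.mul_apply, ih, map_smul, hb, smul_smul, pow_succ]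
  let c := fun i => b.repr x i
  have hx : x = ∑ i, c i • b i := (b.sum_repr x).symm
  refine ⟨∑ i, (if ev i = 1 then c i else 0) • b i, ?_, fun φ => ?_⟩
  · rw [map_sum]
    refine Finset.sum_congr rfl fun i _ => ?_
    rw [map_smul, hb]
    split_ifs with h <;> simp [h]
  · have hφ : ∀ n, φ ((T ^ n) x) = ∑ i, c i * (ev i ^ n * φ (b i)) := fun n => by
      rw [hx, map_sum, map_sum]
      simp [hpow]
    simp_rw [hφ, map_sum, map_smul, smul_eq_mul]
    refine tendsto_finsetSum _ fun i _ => ?_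
    split_ifs with h
    · simp [h]
    · have h1 : |ev i| < 1 := abs_lt.2 ⟨(hev i).1, lt_of_le_of_ne (hev i).2 h⟩
      have := ((tendsto_pow_atTop_nhds_zero_of_abs_lt_one h1).mul_const (φ (b i))).const_mul (c i)
      simpa using this

/-- A functional vanishing on the kernel of `D` is represented by `D` through any positive
definite form on the codomain of `D`. -/
lemma exists_repr_of_ker_le {E F : Type*} [AddCommGroup E] [Module ℝ E] [AddCommGroup F]
    [Module ℝ F] [FiniteDimensional ℝ F] (B : F →ₗ[ℝ] F →ₗ[ℝ] ℝ)
    (hpos : ∀ x, x ≠ 0 → 0 < B x x) (D : E →ₗ[ℝ] F) (φ : E →ₗ[ℝ] ℝ)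
    (hφ : ∀ h, D h = 0 → φ h = 0) : ∃ g, ∀ h, φ h = B g (D h) := by
  have hmem : φ ∈ D.dualMap.range := by
    rw [LinearMap.range_dualMap_eq_dualAnnihilator_ker, Submodule.mem_dualAnnihilator]
    exact fun h hh => hφ h hh
  obtain ⟨ψ, rfl⟩ := hmem
  have hinj : Function.Injective B := by
    rw [← LinearMap.ker_eq_bot, LinearMap.ker_eq_bot']
    intro x hx
    by_contra h
    exact (hpos x h).ne' (by rw [hx, LinearMap.zero_apply])
  obtain ⟨g, rfl⟩ := (LinearMap.injective_iff_surjective_of_finrank_eq_finrank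
    (Subspace.dual_finrank_eq (K := ℝ) (V := F)).symm).1 hinj ψ
  exact ⟨g, fun h => rfl⟩

namespace SComplex

section Tuples

variable {V : Type*}

lemma image_comp_perm {n : ℕ} (σ : Fin n → V) (π : Equiv.Perm (Fin n)) :
    Finset.image (σ ∘ π) Finset.univ = Finset.image σ Finset.univ := by
  rw [← Finset.image_image, Finset.image_univ_equiv]

lemma exists_perm_of_image_eq {n : ℕ} {σ τ : Fin n → V}
    (hτ : Function.Injective τ)
    (h : Finset.image σ Finset.univ = Finset.image τ Finset.univ) :
    ∃ π : Equiv.Perm (Fin n), τ = σ ∘ π := by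
  have hmem : ∀ i, ∃ j, σ j = τ i := fun i => by
    have : τ i ∈ Finset.image σ Finset.univ := h ▸ Finset.mem_image_of_mem τ (Finset.mem_univ i)
    simpa using this
  choose e he using hmem
  have hinj : Function.Injective e := fun i j hij => hτ (by rw [← he, ← he, hij])
  exact ⟨Equiv.ofBijective e (Finite.injective_iff_bijective.1 hinj), funext fun i => (he i).symm⟩

lemma card_image_tuple {n : ℕ} {σ : Fin n → V} (hσ : Function.Injective σ) :
    (Finset.image σ Finset.univ).card = n := by
  rw [Finset.card_image_of_injective _ hσ, Finset.card_univ, Fintype.card_fin]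

lemma image_cons {n : ℕ} (v : V) (σ : Fin n → V) :
    Finset.image (Fin.cons v σ : Fin (n + 1) → V) Finset.univ =
      insert v (Finset.image σ Finset.univ) := by
  ext w
  simp [Fin.exists_fin_succ, eq_comm]

/-- The permutation of `Fin (n + 1)` fixing `0` and acting as `π` on successors. -/
def extPerm {n : ℕ} (π : Equiv.Perm (Fin n)) : Equiv.Perm (Fin (n + 1)) :=
  Equiv.Perm.decomposeFin.symm (0, π)

lemma extPerm_zero {n : ℕ} (π : Equiv.Perm (Fin n)) : extPerm π 0 = 0 := by
  simp [extPerm]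

lemma extPerm_succ {n : ℕ} (π : Equiv.Perm (Fin n)) (i : Fin n) :
    extPerm π i.succ = (π i).succ := by
  simp [extPerm]

lemma sign_extPerm {n : ℕ} (π : Equiv.Perm (Fin n)) :
    Equiv.Perm.sign (extPerm π) = Equiv.Perm.sign π := by
  simp [extPerm]

lemma exists_eq_extPerm {n : ℕ} {ρ : Equiv.Perm (Fin (n + 1))} (h : ρ 0 = 0) :
    ∃ π, ρ = extPerm π := by
  obtain ⟨⟨a, π⟩, rfl⟩ := Equiv.Perm.decomposeFin.symm.surjective ρ
  rw [Equiv.Perm.decomposeFin_symm_apply_zero] at h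
  exact ⟨π, by rw [h, extPerm]⟩

lemma cons_comp_perm {n : ℕ} (v : V) (σ : Fin n → V) (π : Equiv.Perm (Fin n)) :
    (Fin.cons v (σ ∘ π) : Fin (n + 1) → V) = (Fin.cons v σ : Fin (n + 1) → V) ∘ extPerm π := by
  funext i
  refine Fin.cases ?_ (fun i => ?_) i
  · simp [extPerm_zero]
  · simp [extPerm_succ]

lemma comp_succAbove_eq {n : ℕ} (τ : Fin (n + 1) → V) (i : Fin (n + 1)) :
    τ ∘ i.succAbove = (τ ∘ i.cycleRange.symm) ∘ Fin.succ := by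
  funext j
  simp [Fin.cycleRange_symm_succ]

lemma cons_comp_succAbove {n : ℕ} (τ : Fin (n + 1) → V) (i : Fin (n + 1)) :
    (Fin.cons (τ i) (τ ∘ i.succAbove) : Fin (n + 1) → V) = τ ∘ i.cycleRange.symm := by
  funext j
  refine Fin.cases ?_ (fun j => ?_) j
  · simp [Fin.cycleRange_symm_zero]
  · simp [Fin.cycleRange_symm_succ]

lemma cons_comp_succAbove_succ {n : ℕ} (v : V) (σ : Fin (n + 1) → V) (i : Fin (n + 1)) :
    (Fin.cons v σ : Fin (n + 2) → V) ∘ i.succ.succAbove = Fin.cons v (σ ∘ i.succAbove) := by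
  funext j
  refine Fin.cases ?_ (fun j => ?_) j
  · simp
  · simp

lemma cons_comp_succAbove_zero {n : ℕ} (v : V) (σ : Fin n → V) :
    (Fin.cons v σ : Fin (n + 1) → V) ∘ (0 : Fin (n + 1)).succAbove = σ := by
  funext j
  simp

lemma neg_one_pow_mul_self (k : ℕ) : ((-1 : ℝ) ^ k) * (-1) ^ k = 1 := by
  rw [← mul_pow]; simp

lemma cycleRange_comp_succAbove {n : ℕ} (τ : Fin (n + 1) → V) (i : Fin (n + 1)) :
    (τ ∘ i.cycleRange) ∘ i.succAbove = τ ∘ Fin.succ := by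
  rw [comp_succAbove_eq, Function.comp_assoc τ, Equiv.self_comp_symm, Function.comp_id]

/-- An alternating function of `n`-tuples. -/
def IsAlt {n : ℕ} (f : (Fin n → V) → ℝ) : Prop :=
  ∀ (σ : Fin n → V) (π : Equiv.Perm (Fin n)), f (σ ∘ π) = ((Equiv.Perm.sign π : ℤ) : ℝ) * f σ

lemma sign_mul_self {n : ℕ} (π : Equiv.Perm (Fin n)) :
    ((Equiv.Perm.sign π : ℤ) : ℝ) * ((Equiv.Perm.sign π : ℤ) : ℝ) = 1 := by
  rcases Int.units_eq_one_or (Equiv.Perm.sign π) with h | h <;> simp [h]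

lemma sign_cycleRange_symm {n : ℕ} (i : Fin n) :
    ((Equiv.Perm.sign i.cycleRange.symm : ℤ) : ℝ) = (-1) ^ (i : ℕ) := by
  rw [Equiv.Perm.sign_symm, Fin.sign_cycleRange]
  simp

lemma IsAlt.cons_face {n : ℕ} {g : (Fin (n + 1) → V) → ℝ} (hg : IsAlt g) (τ : Fin (n + 1) → V)
    (i : Fin (n + 1)) : g (Fin.cons (τ i) (τ ∘ i.succAbove)) = (-1) ^ (i : ℕ) * g τ := by
  rw [cons_comp_succAbove, hg, sign_cycleRange_symm]

lemma IsAlt.cons_perm {n : ℕ} {g : (Fin (n + 1) → V) → ℝ} (hg : IsAlt g) (v : V)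
    (σ : Fin n → V) (π : Equiv.Perm (Fin n)) :
    g (Fin.cons v (σ ∘ π)) = ((Equiv.Perm.sign π : ℤ) : ℝ) * g (Fin.cons v σ) := by
  rw [cons_comp_perm, hg, sign_extPerm]

lemma IsAlt.sameOr {n : ℕ} {h : (Fin n → V) → ℝ} (hh : IsAlt h) {σ σ' : Fin n → V}
    (hs : SameOr σ σ') : h σ' = h σ := by
  obtain ⟨π, hπ, rfl⟩ := hs
  simp [hh σ π, hπ]

/-- The value of `h` on the `i`-th face of `τ` with its induced orientation. -/
def faceVal {n : ℕ} (h : (Fin n → V) → ℝ) (τ : Fin (n + 1) → V) (i : Fin (n + 1)) : ℝ :=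
  (-1) ^ (i : ℕ) * h (τ ∘ i.succAbove)

lemma IsAlt.faceVal_comp_perm {n : ℕ} {h : (Fin n → V) → ℝ} (hh : IsAlt h)
    (τ : Fin (n + 1) → V) (π : Equiv.Perm (Fin (n + 1))) (i : Fin (n + 1)) :
    faceVal h (τ ∘ π) i = ((Equiv.Perm.sign π : ℤ) : ℝ) * faceVal h τ (π i) := by
  obtain ⟨ρ, hρ⟩ := exists_eq_extPerm
    (ρ := (π i).cycleRange * π * i.cycleRange.symm) (by simp [Fin.cycleRange_symm_zero])
  have hsign := congrArg (fun ρ => ((Equiv.Perm.sign ρ : ℤ) : ℝ)) hρ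
  simp only [map_mul, Units.val_mul, Int.cast_mul, sign_cycleRange_symm, sign_extPerm,
    Fin.sign_cycleRange] at hsign
  push_cast at hsign
  have hface : (τ ∘ π) ∘ i.succAbove = (τ ∘ (π i).succAbove) ∘ ρ := by
    funext j
    have := Equiv.congr_fun hρ j.succ
    rw [extPerm_succ] at this
    simp only [Equiv.Perm.mul_apply, Fin.cycleRange_symm_succ] at this
    simp only [Function.comp_apply]
    rw [← Fin.cycleRange_symm_succ (π i), ← this, Equiv.symm_apply_apply]
  rw [faceVal, faceVal, hface, hh, ← hsign]
  linear_combination ((-1 : ℝ) ^ ((π i : Fin (n + 1)) : ℕ) * ((Equiv.Perm.sign π : ℤ) : ℝ) *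
    h (τ ∘ (π i).succAbove)) * neg_one_pow_mul_self i

lemma swap_zero_one_sign {n : ℕ} :
    Equiv.Perm.sign (Equiv.swap (0 : Fin (n + 2)) 1) = -1 :=
  Equiv.Perm.sign_swap (by simp)

lemma IsAlt.swap {n : ℕ} {h : (Fin (n + 2) → V) → ℝ} (hh : IsAlt h) (σ : Fin (n + 2) → V) :
    h (σ ∘ Equiv.swap 0 1) = -h σ := by
  rw [hh, swap_zero_one_sign]
  simp

end Tuples

end SComplex

namespace SComplex

section Complex

variable {V : Type*} {X : SComplex V}

lemma isCellT_comp_perm {n : ℕ} (σ : Fin n → V) (π : Equiv.Perm (Fin n)) :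
    X.IsCellT (σ ∘ π) ↔ X.IsCellT σ := by
  rw [IsCellT, IsCellT, image_comp_perm, π.injective_comp]

lemma degT_comp_perm {n : ℕ} (σ : Fin n → V) (π : Equiv.Perm (Fin n)) :
    X.degT (σ ∘ π) = X.degT σ := by
  rw [degT, degT, image_comp_perm]

lemma IsCellT.comp {n k : ℕ} {τ : Fin n → V} (hτ : X.IsCellT τ) {e : Fin (k + 1) → Fin n}
    (he : Function.Injective e) : X.IsCellT (τ ∘ e) := by
  refine ⟨hτ.1.comp he, X.down_closed hτ.2 ?_ (Finset.univ_nonempty.image _)⟩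
  intro v hv
  simp only [Finset.mem_image, Finset.mem_univ, true_and, Function.comp_apply] at hv ⊢
  obtain ⟨i, rfl⟩ := hv
  exact ⟨_, rfl⟩

lemma IsCellT.tail {n : ℕ} {v : V} {σ : Fin (n + 1) → V}
    (h : X.IsCellT (Fin.cons v σ : Fin (n + 2) → V)) : X.IsCellT σ := by
  simpa [cons_comp_succAbove_zero] using
    h.comp (Fin.succAbove_right_injective (p := (0 : Fin (n + 2))))

lemma IsForm.isAlt {n : ℕ} {f : (Fin n → V) → ℝ} (hf : X.IsForm n f) : IsAlt f := hf.2

/-- The space of alternating forms on the cells with `n` vertices. -/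
def forms (X : SComplex V) (n : ℕ) : Submodule ℝ ((Fin n → V) → ℝ) where
  carrier := {f | X.IsForm n f}
  add_mem' := by
    rintro f g hf hg
    refine ⟨fun σ hσ => by simp [hf.1 σ hσ, hg.1 σ hσ], fun σ π => ?_⟩
    simp only [Pi.add_apply, hf.2 σ π, hg.2 σ π]
    ring
  zero_mem' := ⟨fun _ _ => rfl, fun _ _ => by simp⟩
  smul_mem' := by
    rintro c f hf
    refine ⟨fun σ hσ => by simp [hf.1 σ hσ], fun σ π => ?_⟩
    simp only [Pi.smul_apply, hf.2 σ π, smul_eq_mul]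
    ring

/-- A form divided by the degrees of the cells. -/
def degScale (X : SComplex V) {n : ℕ} (f : (Fin n → V) → ℝ) : (Fin n → V) → ℝ :=
  fun σ => f σ / X.degT σ

lemma IsForm.degScale {n : ℕ} {f : (Fin n → V) → ℝ} (hf : X.IsForm n f) :
    X.IsForm n (X.degScale f) := by
  refine ⟨fun σ hσ => by simp [SComplex.degScale, hf.1 σ hσ], fun σ π => ?_⟩
  simp only [SComplex.degScale, degT_comp_perm, hf.2 σ π]
  ring

/-- The adjoint of the boundary operator. -/
def cobdry (X : SComplex V) {n : ℕ} (f : (Fin n → V) → ℝ) : (Fin (n + 1) → V) → ℝ :=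
  fun τ => if X.IsCellT τ then ∑ i, faceVal (X.degScale f) τ i else 0

lemma IsForm.cobdry {n : ℕ} {f : (Fin n → V) → ℝ} (hf : X.IsForm n f) :
    X.IsForm (n + 1) (X.cobdry f) := by
  refine ⟨fun τ hτ => if_neg hτ, fun τ π => ?_⟩
  simp only [SComplex.cobdry, isCellT_comp_perm]
  split_ifs
  · rw [Finset.mul_sum, ← Equiv.sum_comp π
      fun i => ((Equiv.Perm.sign π : ℤ) : ℝ) * faceVal (X.degScale f) τ i]
    exact Finset.sum_congr rfl fun i _ => hf.degScale.isAlt.faceVal_comp_perm τ π i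
  · simp

variable [Fintype V]

lemma bdry_apply {n : ℕ} (f : (Fin (n + 1) → V) → ℝ) (σ : Fin n → V) :
    X.bdry f σ = ∑ v, if X.IsCellT (Fin.cons v σ) then f (Fin.cons v σ) else 0 := by
  rw [bdry, finsum_mem_def, finsum_eq_sum_of_fintype]
  exact Finset.sum_congr rfl fun v _ => by simp [Set.indicator_apply]

lemma IsForm.bdry_apply {n : ℕ} {f : (Fin (n + 1) → V) → ℝ} (hf : X.IsForm (n + 1) f)
    (σ : Fin n → V) : X.bdry f σ = ∑ v, f (Fin.cons v σ) := by
  rw [SComplex.bdry_apply]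
  refine Finset.sum_congr rfl fun v _ => ?_
  split_ifs with h
  · rfl
  · rw [hf.1 _ h]

lemma IsForm.bdry {n : ℕ} {f : (Fin (n + 2) → V) → ℝ} (hf : X.IsForm (n + 2) f) :
    X.IsForm (n + 1) (X.bdry f) := by
  refine ⟨fun σ hσ => ?_, fun σ π => ?_⟩
  · rw [hf.bdry_apply]
    exact Finset.sum_eq_zero fun v _ => hf.1 _ fun h => hσ h.tail
  · rw [hf.bdry_apply, hf.bdry_apply, Finset.mul_sum]
    exact Finset.sum_congr rfl fun v _ => hf.isAlt.cons_perm v σ π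

/-- The boundary operator on forms. -/
def bdryₗ (X : SComplex V) (n : ℕ) : X.forms (n + 2) →ₗ[ℝ] X.forms (n + 1) where
  toFun f := ⟨X.bdry f, IsForm.bdry f.2⟩
  map_add' f g := by
    ext σ
    have h := IsForm.bdry_apply (f + g).2 σ
    simp only [Submodule.coe_add, Pi.add_apply, Finset.sum_add_distrib] at h
    simp only [Submodule.coe_add, Pi.add_apply, h, IsForm.bdry_apply f.2, IsForm.bdry_apply g.2]
  map_smul' c f := by
    ext σ
    have h := IsForm.bdry_apply (c • f).2 σ
    simp only [Submodule.coe_smul, Pi.smul_apply, ← Finset.smul_sum] at h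
    simp only [Submodule.coe_smul, Pi.smul_apply, h, IsForm.bdry_apply f.2, RingHom.id_apply]

/-- The coboundary operator on forms. -/
def cobdryₗ (X : SComplex V) (n : ℕ) : X.forms n →ₗ[ℝ] X.forms (n + 1) where
  toFun f := ⟨X.cobdry f, IsForm.cobdry f.2⟩
  map_add' f g := by
    ext τ
    simp only [cobdry, faceVal, degScale, Submodule.coe_add, Pi.add_apply]
    split_ifs
    · rw [← Finset.sum_add_distrib]
      exact Finset.sum_congr rfl fun i _ => by ring
    · simp
  map_smul' c f := by
    ext τ
    simp only [cobdry, faceVal, degScale, Submodule.coe_smul, Pi.smul_apply, smul_eq_mul,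
      RingHom.id_apply]
    split_ifs
    · rw [Finset.mul_sum]
      exact Finset.sum_congr rfl fun i _ => by ring
    · simp

lemma sum_tuple_comp_perm {n : ℕ} (F : (Fin n → V) → ℝ) (π : Equiv.Perm (Fin n)) :
    ∑ τ, F (τ ∘ π) = ∑ τ, F τ :=
  Equiv.sum_comp (π.symm.arrowCongr (Equiv.refl V)) F

lemma sum_tuple_succ {n : ℕ} (F : (Fin (n + 1) → V) → ℝ) :
    ∑ τ, F τ = ∑ σ : Fin n → V, ∑ v, F (Fin.cons v σ) := by
  rw [← Equiv.sum_comp (Fin.consEquiv fun _ : Fin (n + 1) => V), Fintype.sum_prod_type,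
    Finset.sum_comm]
  rfl

lemma sum_isCellT_cons {n : ℕ} {σ : Fin n → V} (hσ : Function.Injective σ) :
    (∑ v, if X.IsCellT (Fin.cons v σ) then (1 : ℝ) else 0) = X.degT σ := by
  rw [Finset.sum_boole]
  norm_cast
  rw [← Set.ncard_coe_finset, degT, degS]
  refine Set.ncard_congr (fun v _ => insert v (Finset.image σ Finset.univ)) ?_ ?_ ?_
  · intro v hv
    simp only [Finset.coe_filter, Finset.mem_univ, true_and, Set.mem_ofPred_eq] at hv
    have hc := card_image_tuple hv.1
    rw [image_cons] at hc
    refine ⟨by simpa [image_cons] using hv.2, ?_, Finset.subset_insert _ _⟩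
    rw [hc, card_image_tuple hσ]
  · intro v w hv hw h
    simp only [Finset.coe_filter, Finset.mem_univ, true_and, Set.mem_ofPred_eq] at hv hw
    have hv' := (Fin.cons_injective_iff.1 hv.1).1
    have : v ∈ insert w (Finset.image σ Finset.univ) := h ▸ Finset.mem_insert_self _ _
    rcases Finset.mem_insert.1 this with h | h
    · exact h
    · exact absurd (by simpa using h) hv'
  · rintro t ⟨ht, hcard, hsub⟩
    obtain ⟨v, hv, hvt⟩ := Finset.exists_eq_insert_iff.2 ⟨hsub, hcard.symm⟩
    refine ⟨v, ?_, hvt⟩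
    simp only [Finset.coe_filter, Finset.mem_univ, true_and, Set.mem_ofPred_eq]
    refine ⟨Fin.cons_injective_iff.2 ⟨by simpa using hv, hσ⟩, ?_⟩
    rw [image_cons, hvt]
    exact ht

end Complex

end SComplex

namespace SComplex

section Energy

variable {V : Type*} {X : SComplex V} [Fintype V]

lemma innerW_bdry {n : ℕ} (f : (Fin n → V) → ℝ) {g : (Fin (n + 1) → V) → ℝ}
    (hg : X.IsForm (n + 1) g) : X.innerW f (X.bdry g) = innerU (X.cobdry f) g := by
  have hW : ∑ σ, f σ * X.bdry g σ / (X.degT σ : ℝ) =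
      ∑ τ : Fin (n + 1) → V, X.degScale f (τ ∘ Fin.succ) * g τ := by
    rw [sum_tuple_succ]
    refine Finset.sum_congr rfl fun σ _ => ?_
    rw [hg.bdry_apply, mul_div_right_comm, Finset.mul_sum]
    rfl
  have hU : ∑ τ, X.cobdry f τ * g τ =
      (n + 1) * ∑ τ : Fin (n + 1) → V, X.degScale f (τ ∘ Fin.succ) * g τ := by
    have h1 : ∀ τ, X.cobdry f τ * g τ = ∑ i, faceVal (X.degScale f) τ i * g τ := fun τ => by
      rw [cobdry]
      split_ifs with h
      · rw [Finset.sum_mul]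
      · simp [hg.1 τ h]
    have h2 : ∀ i : Fin (n + 1), ∑ τ, faceVal (X.degScale f) τ i * g τ =
        ∑ τ : Fin (n + 1) → V, X.degScale f (τ ∘ Fin.succ) * g τ := fun i => by
      rw [← sum_tuple_comp_perm _ i.cycleRange]
      refine Finset.sum_congr rfl fun τ _ => ?_
      rw [hg.2 τ, ← Equiv.Perm.sign_symm, sign_cycleRange_symm, faceVal, cycleRange_comp_succAbove]
      linear_combination (X.degScale f (τ ∘ Fin.succ) * g τ) * neg_one_pow_mul_self i
    simp_rw [h1]
    rw [Finset.sum_comm, Finset.sum_congr rfl fun i _ => h2 i]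
    simp
  rw [innerW, innerU, hW, hU, Nat.factorial_succ]
  push_cast
  field_simp

lemma sum_faceVal_sq {n : ℕ} {h : (Fin n → V) → ℝ} (hh : ∀ σ, ¬ X.IsCellT σ → h σ = 0)
    (i : Fin (n + 1)) :
    (∑ τ, if X.IsCellT τ then faceVal h τ i ^ 2 else 0) = ∑ σ, (X.degT σ : ℝ) * h σ ^ 2 := by
  rw [← sum_tuple_comp_perm _ i.cycleRange, sum_tuple_succ]
  refine Finset.sum_congr rfl fun σ _ => ?_
  have h1 : ∀ τ : Fin (n + 1) → V, faceVal h (τ ∘ i.cycleRange) i ^ 2 = h (τ ∘ Fin.succ) ^ 2 := by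
    intro τ
    rw [faceVal, mul_pow, ← pow_mul, mul_comm (i : ℕ), pow_mul, cycleRange_comp_succAbove]
    simp
  simp only [isCellT_comp_perm, h1]
  by_cases hσ : Function.Injective σ
  · rw [← sum_isCellT_cons hσ, Finset.sum_mul]
    refine Finset.sum_congr rfl fun v _ => ?_
    split_ifs
    · rw [one_mul]; rfl
    · simp
  · have h0 : h σ = 0 := hh σ fun hc => hσ hc.1
    rw [h0]
    refine (Finset.sum_eq_zero fun v _ => ?_).trans (by simp)
    split_ifs
    · exact (congrArg (· ^ 2) h0).trans (by simp)
    · rfl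

/-- The energy gap: `‖∂^* f‖² ≤ (n + 1) ‖f‖²`, with the defect written as a sum of squares. -/
lemma energy_defect {n : ℕ} {f : (Fin n → V) → ℝ} (hf : X.IsForm n f) :
    ((n : ℝ) + 1) * (((n : ℝ) + 1) * X.innerW f f - innerU (X.cobdry f) (X.cobdry f)) =
      1 / ((n + 1).factorial : ℝ) * ∑ τ, ∑ i, if X.IsCellT τ then
        (((n : ℝ) + 1) * faceVal (X.degScale f) τ i - X.cobdry f τ) ^ 2 else 0 := by
  have h1 : ∀ τ, (∑ i, if X.IsCellT τ then
      (((n : ℝ) + 1) * faceVal (X.degScale f) τ i - X.cobdry f τ) ^ 2 else 0) =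
      ((n : ℝ) + 1) ^ 2 * (∑ i, if X.IsCellT τ then faceVal (X.degScale f) τ i ^ 2 else 0) -
        ((n : ℝ) + 1) * (X.cobdry f τ * X.cobdry f τ) := by
    intro τ
    by_cases hτ : X.IsCellT τ
    · have hS : X.cobdry f τ = ∑ i, faceVal (X.degScale f) τ i := if_pos hτ
      simp only [if_pos hτ, sub_sq, mul_pow, Finset.sum_add_distrib, Finset.sum_sub_distrib,
        ← Finset.mul_sum, ← Finset.sum_mul, ← hS, Finset.sum_const, Finset.card_univ,
        Fintype.card_fin, nsmul_eq_mul]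
      push_cast
      ring
    · have hS : X.cobdry f τ = 0 := if_neg hτ
      simp [hτ, hS]
  have h2 : ∑ τ, ∑ i, (if X.IsCellT τ then faceVal (X.degScale f) τ i ^ 2 else 0) =
      ((n : ℝ) + 1) * ∑ σ, f σ * f σ / (X.degT σ : ℝ) := by
    rw [Finset.sum_comm, Finset.sum_congr rfl fun i _ => sum_faceVal_sq hf.degScale.1 i]
    simp only [Finset.sum_const, Finset.card_univ, Fintype.card_fin, nsmul_eq_mul]
    push_cast
    congr 1
    refine Finset.sum_congr rfl fun σ _ => ?_
    rw [degScale]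
    rcases eq_or_ne (X.degT σ : ℝ) 0 with h | h
    · simp [h]
    · field_simp
  simp_rw [h1, Finset.sum_sub_distrib, ← Finset.mul_sum, h2, innerW, innerU, Nat.factorial_succ]
  push_cast
  field_simp

lemma innerU_self_nonneg {n : ℕ} (f : (Fin n → V) → ℝ) : 0 ≤ innerU f f := by
  unfold innerU
  have : 0 ≤ ∑ σ : Fin n → V, f σ * f σ := Finset.sum_nonneg fun σ _ => mul_self_nonneg _
  positivity

lemma energy_le {n : ℕ} {f : (Fin n → V) → ℝ} (hf : X.IsForm n f) :
    innerU (X.cobdry f) (X.cobdry f) ≤ ((n : ℝ) + 1) * X.innerW f f := by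
  have h := energy_defect hf
  have h0 : 0 ≤ 1 / ((n + 1).factorial : ℝ) * ∑ τ, ∑ i, (if X.IsCellT τ then
        (((n : ℝ) + 1) * faceVal (X.degScale f) τ i - X.cobdry f τ) ^ 2 else 0) := by
    refine mul_nonneg (by positivity) (Finset.sum_nonneg fun τ _ => Finset.sum_nonneg fun i _ => ?_)
    split_ifs <;> positivity
  rw [← h] at h0
  have := nonneg_of_mul_nonneg_right h0 (by positivity)
  linarith

lemma faceVal_of_energy_eq {n : ℕ} {f : (Fin n → V) → ℝ} (hf : X.IsForm n f)
    (he : innerU (X.cobdry f) (X.cobdry f) = ((n : ℝ) + 1) * X.innerW f f)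
    {τ : Fin (n + 1) → V} (hτ : X.IsCellT τ) (i : Fin (n + 1)) :
    ((n : ℝ) + 1) * faceVal (X.degScale f) τ i = X.cobdry f τ := by
  have h := energy_defect hf
  rw [he, sub_self, mul_zero] at h
  have h1 := (mul_eq_zero.1 h.symm).resolve_left (by positivity)
  have hnn : ∀ (τ : Fin (n + 1) → V) (i : Fin (n + 1)), 0 ≤ (if X.IsCellT τ then
      (((n : ℝ) + 1) * faceVal (X.degScale f) τ i - X.cobdry f τ) ^ 2 else 0) := by
    intro τ i
    split_ifs <;> positivity
  rw [Finset.sum_eq_zero_iff_of_nonneg fun τ _ => Finset.sum_nonneg fun i _ => hnn τ i] at h1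
  have h2 := h1 τ (Finset.mem_univ _)
  rw [Finset.sum_eq_zero_iff_of_nonneg fun i _ => hnn τ i] at h2
  have h3 := h2 i (Finset.mem_univ _)
  rw [if_pos hτ] at h3
  linarith [pow_eq_zero_iff (two_ne_zero) |>.1 h3]

/-- The weighted inner product as a bilinear map on forms. -/
def innerWₗ (X : SComplex V) (n : ℕ) : X.forms n →ₗ[ℝ] X.forms n →ₗ[ℝ] ℝ :=
  LinearMap.mk₂ ℝ (fun f g => X.innerW f.1 g.1)
    (fun f f' g => by
      simp only [innerW, Submodule.coe_add, Pi.add_apply, add_mul, add_div,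
        Finset.sum_add_distrib, mul_add])
    (fun c f g => by
      simp only [innerW, Submodule.coe_smul, Pi.smul_apply, smul_eq_mul, Finset.mul_sum]
      exact Finset.sum_congr rfl fun σ _ => by ring)
    (fun f g g' => by
      simp only [innerW, Submodule.coe_add, Pi.add_apply, mul_add, add_div,
        Finset.sum_add_distrib])
    (fun c f g => by
      simp only [innerW, Submodule.coe_smul, Pi.smul_apply, smul_eq_mul, Finset.mul_sum]
      exact Finset.sum_congr rfl fun σ _ => by ring)

/-- The unweighted inner product as a bilinear map on forms. -/
def innerUₗ (X : SComplex V) (n : ℕ) : X.forms n →ₗ[ℝ] X.forms n →ₗ[ℝ] ℝ :=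
  LinearMap.mk₂ ℝ (fun f g => innerU f.1 g.1)
    (fun f f' g => by
      simp only [innerU, Submodule.coe_add, Pi.add_apply, add_mul,
        Finset.sum_add_distrib, mul_add])
    (fun c f g => by
      simp only [innerU, Submodule.coe_smul, Pi.smul_apply, smul_eq_mul, Finset.mul_sum]
      exact Finset.sum_congr rfl fun σ _ => by ring)
    (fun f g g' => by
      simp only [innerU, Submodule.coe_add, Pi.add_apply, mul_add,
        Finset.sum_add_distrib])
    (fun c f g => by
      simp only [innerU, Submodule.coe_smul, Pi.smul_apply, smul_eq_mul, Finset.mul_sum]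
      exact Finset.sum_congr rfl fun σ _ => by ring)

lemma innerWₗ_apply {n : ℕ} (f g : X.forms n) : X.innerWₗ n f g = X.innerW f.1 g.1 := rfl

lemma innerUₗ_apply {n : ℕ} (f g : X.forms n) : X.innerUₗ n f g = innerU f.1 g.1 := rfl

lemma innerW_comm {n : ℕ} (f g : (Fin n → V) → ℝ) : X.innerW f g = X.innerW g f := by
  simp only [innerW, mul_comm]

lemma innerU_comm {n : ℕ} (f g : (Fin n → V) → ℝ) : innerU f g = innerU g f := by
  simp only [innerU, mul_comm]

lemma innerUₗ_self_pos {n : ℕ} (f : X.forms n) (hf : f ≠ 0) : 0 < X.innerUₗ n f f := by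
  obtain ⟨σ, hσ⟩ : ∃ σ, f.1 σ ≠ 0 := by
    by_contra! h
    exact hf (Subtype.ext (funext h))
  have : 0 < ∑ σ : Fin n → V, f.1 σ * f.1 σ :=
    Finset.sum_pos' (fun σ _ => mul_self_nonneg _)
      ⟨σ, Finset.mem_univ _, mul_self_pos.2 hσ⟩
  rw [innerUₗ_apply, innerU]
  positivity

lemma innerWₗ_self_pos {n : ℕ} (hdeg : ∀ σ : Fin n → V, X.IsCellT σ → 0 < X.degT σ)
    (f : X.forms n) (hf : f ≠ 0) : 0 < X.innerWₗ n f f := by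
  obtain ⟨σ, hσ⟩ : ∃ σ, f.1 σ ≠ 0 := by
    by_contra! h
    exact hf (Subtype.ext (funext h))
  have hσd : 0 < (X.degT σ : ℝ) := by
    exact_mod_cast hdeg σ (by by_contra h; exact hσ (f.2.1 σ h))
  have : 0 < ∑ σ : Fin n → V, f.1 σ * f.1 σ / (X.degT σ : ℝ) :=
    Finset.sum_pos' (fun σ _ => div_nonneg (mul_self_nonneg _) (by positivity))
      ⟨σ, Finset.mem_univ _, div_pos (mul_self_pos.2 hσ) hσd⟩
  rw [innerWₗ_apply, innerW]
  positivity

lemma nbrW_eq {n : ℕ} (hdeg : ∀ σ : Fin (n + 1) → V, X.IsCellT σ → 0 < X.degT σ)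
    {f : (Fin (n + 1) → V) → ℝ} (hf : X.IsForm (n + 1) f) (σ : Fin (n + 1) → V) :
    X.nbrW f σ = f σ - X.bdry (X.cobdry f) σ := by
  have h1 : X.nbrW f σ = ∑ v, if X.IsCellT (Fin.cons v σ) then
      ∑ i : Fin (n + 1), (-1 : ℝ) ^ (i : ℕ) * f (Fin.cons v (σ ∘ i.succAbove)) /
        (X.degT (Fin.cons v (σ ∘ i.succAbove)) : ℝ) else 0 := by
    rw [nbrW, finsum_mem_def, finsum_eq_sum_of_fintype]
    exact Finset.sum_congr rfl fun v _ => by simp [Set.indicator_apply]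
  have h2 : ∀ v, X.cobdry f (Fin.cons v σ) = (if X.IsCellT (Fin.cons v σ) then 1 else 0) *
      X.degScale f σ - if X.IsCellT (Fin.cons v σ) then
      ∑ i : Fin (n + 1), (-1 : ℝ) ^ (i : ℕ) * f (Fin.cons v (σ ∘ i.succAbove)) /
        (X.degT (Fin.cons v (σ ∘ i.succAbove)) : ℝ) else 0 := fun v => by
    rw [cobdry]
    split_ifs
    · rw [Fin.sum_univ_succ, sub_eq_add_neg]
      simp only [faceVal, cons_comp_succAbove_zero, cons_comp_succAbove_succ]
      rw [← Finset.sum_neg_distrib]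
      congr 1
      refine Finset.sum_congr rfl fun i _ => ?_
      rw [degScale, Fin.val_succ, pow_succ]
      ring
    · simp
  rw [h1, hf.cobdry.bdry_apply]
  simp_rw [h2]
  rw [Finset.sum_sub_distrib, ← Finset.sum_mul]
  have h3 : (∑ v, if X.IsCellT (Fin.cons v σ) then (1 : ℝ) else 0) * X.degScale f σ = f σ := by
    by_cases hσ : X.IsCellT σ
    · have : (X.degT σ : ℝ) ≠ 0 := by exact_mod_cast (hdeg σ hσ).ne'
      rw [sum_isCellT_cons hσ.1, degScale]
      field_simp
    · simp [degScale, hf.1 σ hσ]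
  rw [h3]
  ring

end Energy

end SComplex

namespace SComplex

section Disorientation

variable {V : Type*} {X : SComplex V}

lemma dirac_comp_perm {n : ℕ} {σ : Fin n → V} (hσ : Function.Injective σ)
    (π : Equiv.Perm (Fin n)) : dirac σ (σ ∘ π) = ((Equiv.Perm.sign π : ℤ) : ℝ) := by
  have huniq : ∀ π' : Equiv.Perm (Fin n), σ ∘ π = σ ∘ π' → π = π' := fun π' h =>
    Equiv.ext fun i => hσ (congrFun h i)
  unfold dirac
  rcases Int.units_eq_one_or (Equiv.Perm.sign π) with h | h
  · rw [if_pos ⟨π, h, rfl⟩, h]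
    simp
  · rw [if_neg, if_pos ⟨π, h, rfl⟩, h]
    · simp
    · rintro ⟨π', h', he⟩
      rw [← huniq π' he, h] at h'
      exact absurd h' (by decide)

lemma dirac_self {n : ℕ} {σ : Fin n → V} (hσ : Function.Injective σ) : dirac σ σ = 1 := by
  simpa using dirac_comp_perm hσ 1

lemma dirac_eq_zero {n : ℕ} {σ ρ : Fin n → V} (h : ¬ ∃ π : Equiv.Perm (Fin n), ρ = σ ∘ π) :
    dirac σ ρ = 0 := by
  unfold dirac
  rw [if_neg fun ⟨π, _, hπ⟩ => h ⟨π, hπ⟩, if_neg fun ⟨π, _, hπ⟩ => h ⟨π, hπ⟩]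

lemma isAlt_dirac {n : ℕ} {σ : Fin n → V} (hσ : Function.Injective σ) : IsAlt (dirac σ) := by
  intro ρ π
  by_cases h : ∃ π' : Equiv.Perm (Fin n), ρ = σ ∘ π'
  · obtain ⟨π', rfl⟩ := h
    have : (σ ∘ π') ∘ π = σ ∘ (π' * π : Equiv.Perm (Fin n)) := rfl
    rw [this, dirac_comp_perm hσ, dirac_comp_perm hσ, Equiv.Perm.sign_mul]
    push_cast
    ring
  · rw [dirac_eq_zero h, dirac_eq_zero, mul_zero]
    rintro ⟨π', h'⟩
    refine h ⟨π' * π⁻¹, ?_⟩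
    rw [Equiv.Perm.coe_mul, ← Function.comp_assoc, ← h', Function.comp_assoc,
      ← Equiv.Perm.coe_mul, mul_inv_cancel, Equiv.Perm.coe_one, Function.comp_id]

lemma isForm_dirac {n : ℕ} {σ : Fin n → V} (hσ : X.IsCellT σ) : X.IsForm n (dirac σ) := by
  refine ⟨fun ρ hρ => dirac_eq_zero ?_, isAlt_dirac hσ.1⟩
  rintro ⟨π, rfl⟩
  exact hρ ((isCellT_comp_perm σ π).2 hσ)

lemma innerW_dirac [Fintype V] {n : ℕ} {σ : Fin n → V} (hσ : Function.Injective σ)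
    {f : (Fin n → V) → ℝ} (hf : IsAlt f) : X.innerW (dirac σ) f = f σ / X.degT σ := by
  have h : ∑ _π : Equiv.Perm (Fin n), f σ / (X.degT σ : ℝ) =
      ∑ ρ, dirac σ ρ * f ρ / (X.degT ρ : ℝ) := by
    refine Fintype.sum_of_injective (fun π : Equiv.Perm (Fin n) => σ ∘ π) ?_ _ _ ?_ ?_
    · exact fun π π' h => Equiv.ext fun i => hσ (congrFun h i)
    · intro ρ hρ
      rw [dirac_eq_zero fun ⟨π, h⟩ => hρ ⟨π, h.symm⟩]
      simp
    · intro π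
      simp only [dirac_comp_perm hσ, degT_comp_perm, hf σ π, ← mul_assoc, sign_mul_self, one_mul]
  rw [innerW, ← h, Finset.sum_const, Finset.card_univ, Fintype.card_perm, Fintype.card_fin,
    nsmul_eq_mul]
  have : (n.factorial : ℝ) ≠ 0 := by positivity
  field_simp

lemma image_comp_succAbove {n : ℕ} {τ : Fin (n + 1) → V} (hτ : Function.Injective τ)
    (i : Fin (n + 1)) : Finset.image (τ ∘ i.succAbove) Finset.univ =
      (Finset.image τ Finset.univ).erase (τ i) := by
  ext v
  simp only [Finset.mem_image, Finset.mem_univ, true_and, Finset.mem_erase, Function.comp_apply]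
  constructor
  · rintro ⟨j, rfl⟩
    exact ⟨fun h => Fin.succAbove_ne i j (hτ h), _, rfl⟩
  · rintro ⟨hne, j, rfl⟩
    obtain ⟨k, rfl⟩ := Fin.exists_succAbove_eq (fun h : j = i => hne (by rw [h]))
    exact ⟨k, rfl⟩

lemma exists_image_comp_succAbove {n : ℕ} {τ : Fin (n + 1) → V} (hτ : Function.Injective τ)
    {s : Finset V} (hs : s ⊆ Finset.image τ Finset.univ) (hcard : s.card = n) :
    ∃ i : Fin (n + 1), Finset.image (τ ∘ i.succAbove) Finset.univ = s := by
  obtain ⟨v, hv, hvs⟩ := Finset.exists_eq_insert_iff.2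
    ⟨hs, by rw [hcard, card_image_tuple hτ]⟩
  obtain ⟨i, -, rfl⟩ := Finset.mem_image.1 (hvs ▸ Finset.mem_insert_self v s)
  exact ⟨i, by rw [image_comp_succAbove hτ, ← hvs, Finset.erase_insert hv]⟩

lemma exists_cons_image {n : ℕ} {σ : Fin n → V} (hσ : Function.Injective σ) {t : Finset V}
    (hs : Finset.image σ Finset.univ ⊆ t) (hcard : t.card = n + 1) :
    ∃ v, Function.Injective (Fin.cons v σ : Fin (n + 1) → V) ∧
      Finset.image (Fin.cons v σ : Fin (n + 1) → V) Finset.univ = t := by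
  obtain ⟨v, hv, hvs⟩ := Finset.exists_eq_insert_iff.2
    ⟨hs, by rw [hcard, card_image_tuple hσ]⟩
  exact ⟨v, Fin.cons_injective_iff.2 ⟨by simpa using hv, hσ⟩, by rw [image_cons, hvs]⟩

lemma IsInducedFace.exists_faceVal {n : ℕ} {σ : Fin (n + 2) → V} {τ : Fin (n + 3) → V}
    (h : IsInducedFace σ τ) :
    ∃ i : Fin (n + 3), Finset.image σ Finset.univ = Finset.image (τ ∘ i.succAbove) Finset.univ ∧
      ∀ f : (Fin (n + 2) → V) → ℝ, IsAlt f → f σ = faceVal f τ i := by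
  obtain ⟨i, hi⟩ := h
  refine ⟨i, ?_⟩
  split_ifs at hi with he
  · refine ⟨?_, fun f hf => ?_⟩
    · obtain ⟨π, -, hπ⟩ := hi
      rw [hπ, image_comp_perm]
    · rw [← hf.sameOr hi, faceVal, he.neg_one_pow, one_mul]
  · refine ⟨?_, fun f hf => ?_⟩
    · obtain ⟨π, -, hπ⟩ := hi
      rw [← image_comp_perm σ π, ← hπ, ← Function.comp_assoc, image_comp_perm]
    · rw [← hf.sameOr hi, ← Function.comp_assoc, hf.swap, faceVal,
        (Nat.not_even_iff_odd.1 he).neg_one_pow, neg_one_mul]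

lemma isInducedFace_of_faceVal {n : ℕ} {f : (Fin (n + 2) → V) → ℝ} (hf : IsAlt f)
    {σ : Fin (n + 2) → V} {τ : Fin (n + 3) → V} (hτ : Function.Injective τ) {i : Fin (n + 3)}
    (himage : Finset.image σ Finset.univ = Finset.image (τ ∘ i.succAbove) Finset.univ)
    (hpos : 0 < f σ) (hpos' : 0 < faceVal f τ i) : IsInducedFace σ τ := by
  obtain ⟨π, hπ⟩ := exists_perm_of_image_eq
    (hτ.comp (Fin.succAbove_right_injective (p := i))) himage
  rw [faceVal, hπ, hf] at hpos'
  refine ⟨i, ?_⟩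
  split_ifs with he
  · rcases Int.units_eq_one_or (Equiv.Perm.sign π) with h | h
    · exact ⟨π, h, hπ⟩
    · rw [he.neg_one_pow, h] at hpos'
      simp at hpos'
      linarith
  · rcases Int.units_eq_one_or (Equiv.Perm.sign π) with h | h
    · rw [(Nat.not_even_iff_odd.1 he).neg_one_pow, h] at hpos'
      simp at hpos'
      linarith
    · refine ⟨π * Equiv.swap 0 1, ?_, ?_⟩
      · rw [Equiv.Perm.sign_mul, h, swap_zero_one_sign]
        simp
      · rw [← Function.comp_assoc, hπ]
        rfl

lemma IsAlt.exists_face {n : ℕ} {f : (Fin (n + 2) → V) → ℝ} (hf : IsAlt f)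
    {τ : Fin (n + 3) → V} (hτ : Function.Injective τ) (i : Fin (n + 3)) :
    ∃ σ : Fin (n + 2) → V, Function.Injective σ ∧
      Finset.image σ Finset.univ = Finset.image (τ ∘ i.succAbove) Finset.univ ∧
      f σ = faceVal f τ i := by
  have hinj := hτ.comp (Fin.succAbove_right_injective (p := i))
  rcases Nat.even_or_odd (i : ℕ) with he | ho
  · exact ⟨τ ∘ i.succAbove, hinj, rfl, by rw [faceVal, he.neg_one_pow, one_mul]⟩
  · refine ⟨(τ ∘ i.succAbove) ∘ Equiv.swap 0 1, hinj.comp (Equiv.injective _),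
      image_comp_perm _ _, ?_⟩
    rw [hf.swap, faceVal, ho.neg_one_pow, neg_one_mul]

lemma SameOr.isCellT_iff {n : ℕ} {σ σ' : Fin n → V} (h : SameOr σ σ') :
    X.IsCellT σ ↔ X.IsCellT σ' := by
  obtain ⟨π, -, rfl⟩ := h
  exact (isCellT_comp_perm σ π).symm

lemma Nbr.isCellT {n : ℕ} {σ σ' : Fin (n + 1) → V} (h : X.Nbr σ σ') :
    X.IsCellT σ ∧ X.IsCellT σ' := by
  obtain ⟨v, i, hc, hi⟩ := h
  have h1 : X.IsCellT (Fin.cons v (σ ∘ i.succAbove) : Fin (n + 1) → V) := by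
    rw [← cons_comp_succAbove_succ]
    exact hc.comp Fin.succAbove_right_injective
  refine ⟨hc.tail, ?_⟩
  split_ifs at hi
  · exact hi.isCellT_iff.2 h1
  · exact hi.isCellT_iff.2 ((isCellT_comp_perm _ _).2 h1)

lemma isCellT_iff_of_eqvGen {n : ℕ} {σ σ' : Fin (n + 1) → V}
    (h : Relation.EqvGen X.Nbr σ σ') : X.IsCellT σ ↔ X.IsCellT σ' := by
  induction h with
  | rel _ _ h => exact iff_of_true h.isCellT.1 h.isCellT.2
  | refl _ => rfl
  | symm _ _ _ ih => exact ih.symm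
  | trans _ _ _ _ _ ih₁ ih₂ => exact ih₁.trans ih₂

/-- The top-dimensional cells of the component of `σ₀`. -/
def componentCells (X : SComplex V) (m : ℕ) (σ₀ : Fin (m + 2) → V) : Set (Finset V) :=
  {t : Finset V | t ∈ X.cells ∧ t.card = m + 3 ∧
    ∃ σ : Fin (m + 2) → V, Relation.EqvGen X.Nbr σ₀ σ ∧ Finset.image σ Finset.univ ⊆ t}

lemma mem_componentCells_of_face {m : ℕ} {σ₀ : Fin (m + 2) → V} (hσ₀ : X.IsCellT σ₀)
    {t t' : Finset V} (ht : t ∈ X.componentCells m σ₀) (ht' : t' ∈ X.cells)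
    (hcard' : t'.card = m + 3) {s : Finset V} (hs : s.card = m + 2) (hst : s ⊆ t)
    (hst' : s ⊆ t') : t' ∈ X.componentCells m σ₀ := by
  obtain ⟨htc, hcard, σ, hσ, hσt⟩ := ht
  have hσc := (isCellT_iff_of_eqvGen hσ).1 hσ₀
  have hσcard := card_image_tuple hσc.1
  refine ⟨ht', hcard', ?_⟩
  by_cases heq : s = Finset.image σ Finset.univ
  · exact ⟨σ, hσ, heq ▸ hst'⟩
  obtain ⟨v, hinj, hv⟩ := exists_cons_image hσc.1 hσt hcard
  have hcell : X.IsCellT (Fin.cons v σ : Fin (m + 3) → V) := ⟨hinj, hv ▸ htc⟩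
  obtain ⟨j, hj⟩ := exists_image_comp_succAbove hinj (hv ▸ hst) hs
  obtain ⟨i, rfl⟩ : ∃ i : Fin (m + 2), j = i.succ := by
    refine ((Fin.exists_succ_eq (x := j)).2 ?_).imp fun _ h => h.symm
    rintro rfl
    rw [cons_comp_succAbove_zero] at hj
    exact heq hj.symm
  rw [cons_comp_succAbove_succ] at hj
  rcases Nat.even_or_odd (i : ℕ) with he | ho
  · refine ⟨Fin.cons v (σ ∘ i.succAbove), hσ.trans _ _ _ (.rel _ _ ⟨v, i, hcell, ?_⟩), hj ▸ hst'⟩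
    rw [if_pos he]
    exact ⟨1, by simp, by simp⟩
  · refine ⟨(Fin.cons v (σ ∘ i.succAbove) : Fin (m + 2) → V) ∘ Equiv.swap 0 1,
      hσ.trans _ _ _ (.rel _ _ ⟨v, i, hcell, ?_⟩), ?_⟩
    · rw [if_neg (Nat.not_even_iff_odd.2 ho)]
      exact ⟨1, by simp, by simp⟩
    · rw [image_comp_perm, hj]
      exact hst'

lemma abs_eq_of_eqvGen {m : ℕ} {h : (Fin (m + 2) → V) → ℝ} (hh : IsAlt h)
    {S : (Fin (m + 3) → V) → ℝ} (hS : ∀ τ, X.IsCellT τ → ∀ i, faceVal h τ i = S τ)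
    {σ σ' : Fin (m + 2) → V} (hσ : Relation.EqvGen X.Nbr σ σ') : |h σ| = |h σ'| := by
  induction hσ with
  | rel σ σ' hn =>
    obtain ⟨v, i, hc, hi⟩ := hn
    have h1 : |h σ| = |h (Fin.cons v (σ ∘ i.succAbove))| := by
      have := (hS _ hc 0).trans (hS _ hc i.succ).symm
      rw [faceVal, faceVal, cons_comp_succAbove_zero, cons_comp_succAbove_succ] at this
      simpa [abs_mul] using congrArg abs this
    rw [h1]
    split_ifs at hi
    · rw [hh.sameOr hi]
    · rw [← hh.sameOr hi, hh.swap, abs_neg]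
  | refl _ => rfl
  | symm _ _ _ ih => exact ih.symm
  | trans _ _ _ _ _ ih₁ ih₂ => exact ih₁.trans ih₂

/-- A nonzero form whose values on the faces of every top cell, with induced orientations, agree
makes the component of any cell in its support disorientable. -/
lemma hasDisorientation_of_faceVal {m : ℕ} {h : (Fin (m + 2) → V) → ℝ} (hh : IsAlt h)
    {S : (Fin (m + 3) → V) → ℝ} (hS : ∀ τ, X.IsCellT τ → ∀ i, faceVal h τ i = S τ)
    (hSalt : IsAlt S) {σ₀ : Fin (m + 2) → V} (hσ₀ : X.IsCellT σ₀) (h0 : h σ₀ ≠ 0) :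
    HasDisorientation m (X.componentCells m σ₀) := by
  have hex : ∀ t, ∃ τ : Fin (m + 3) → V, t ∈ X.componentCells m σ₀ →
      Function.Injective τ ∧ Finset.image τ Finset.univ = t ∧ 0 < S τ := by
    intro t
    by_cases ht : t ∈ X.componentCells m σ₀
    · obtain ⟨htc, hcard, σ, hσ, hσt⟩ := ht
      have hσc := (isCellT_iff_of_eqvGen hσ).1 hσ₀
      obtain ⟨v, hinj, hv⟩ := exists_cons_image hσc.1 hσt hcard
      have hne : S (Fin.cons v σ) ≠ 0 := by
        rw [← hS _ ⟨hinj, hv ▸ htc⟩ 0, faceVal, cons_comp_succAbove_zero]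
        have : h σ ≠ 0 := by rwa [← abs_ne_zero, ← abs_eq_of_eqvGen hh hS hσ, abs_ne_zero]
        simpa using this
      rcases lt_or_gt_of_ne hne with hlt | hgt
      · refine ⟨(Fin.cons v σ : Fin (m + 3) → V) ∘ Equiv.swap 0 1, fun _ =>
          ⟨hinj.comp (Equiv.injective _), by rw [image_comp_perm, hv], ?_⟩⟩
        rw [hSalt.swap]
        linarith
      · exact ⟨_, fun _ => ⟨hinj, hv, hgt⟩⟩
    · exact ⟨fun _ => σ₀ 0, fun h => absurd h ht⟩
  choose c hc using hex
  refine ⟨c, fun t ht => ⟨(hc t ht).1, (hc t ht).2.1⟩, fun t ht t' ht' _ hcard => ?_⟩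
  obtain ⟨hinj, him, hpos⟩ := hc t ht
  obtain ⟨hinj', him', hpos'⟩ := hc t' ht'
  obtain ⟨i, hi⟩ := exists_image_comp_succAbove hinj
    (him.symm ▸ Finset.inter_subset_left : t ∩ t' ⊆ _) hcard
  obtain ⟨j, hj⟩ := exists_image_comp_succAbove hinj'
    (him'.symm ▸ Finset.inter_subset_right : t ∩ t' ⊆ _) hcard
  have hi' := hS (c t) ⟨hinj, him.symm ▸ ht.1⟩ i
  have hj' := hS (c t') ⟨hinj', him'.symm ▸ ht'.1⟩ j
  obtain ⟨σ, hσinj, hσim, hσ⟩ := hh.exists_face hinj i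
  have hσpos : 0 < h σ := by rw [hσ, hi']; exact hpos
  exact ⟨σ, hσinj, hσim.trans hi,
    isInducedFace_of_faceVal hh hinj hσim hσpos (hi'.symm ▸ hpos),
    isInducedFace_of_faceVal hh hinj' (hσim.trans (hi.trans hj.symm)) hσpos (hj'.symm ▸ hpos')⟩

/-- A disorientation of a component yields a nonzero top form on which `∂^* ∂` acts as `d + 1`. -/
lemma exists_form_of_hasDisorientation [Fintype V] {m : ℕ}
    (huni : ∀ s ∈ X.cells, ∃ t ∈ X.cells, t.card = m + 3 ∧ s ⊆ t)
    (hdeg : ∀ σ : Fin (m + 2) → V, X.IsCellT σ → 0 < X.degT σ)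
    {σ₀ : Fin (m + 2) → V} (hσ₀ : X.IsCellT σ₀)
    (hdis : HasDisorientation m (X.componentCells m σ₀)) :
    ∃ g : (Fin (m + 3) → V) → ℝ, X.IsForm (m + 3) g ∧ (∃ τ, g τ ≠ 0) ∧
      ∀ τ, X.cobdry (X.bdry g) τ = (m + 3) * g τ := by
  obtain ⟨c, hc, hface⟩ := hdis
  let g : (Fin (m + 3) → V) → ℝ := fun τ =>
    if Finset.image τ Finset.univ ∈ X.componentCells m σ₀ then
      dirac (c (Finset.image τ Finset.univ)) τ else 0
  have hg : X.IsForm (m + 3) g := by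
    refine ⟨fun τ hτ => ?_, fun τ π => ?_⟩
    · simp only [g]
      split_ifs with h
      · refine dirac_eq_zero ?_
        rintro ⟨π, hπ⟩
        refine hτ ⟨?_, h.1⟩
        rw [hπ]
        exact (hc _ h).1.comp π.injective
      · rfl
    · simp only [g, image_comp_perm]
      split_ifs with h
      · exact isAlt_dirac (hc _ h).1 τ π
      · simp
  have hgc : ∀ t ∈ X.componentCells m σ₀, g (c t) = 1 := fun t ht => by
    simp only [g, (hc t ht).2, if_pos ht, dirac_self (hc t ht).1]
  have hval : ∀ t ∈ X.componentCells m σ₀, ∀ (σ σ' : Fin (m + 2) → V) (v : V)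
      (π : Equiv.Perm (Fin (m + 2))), IsInducedFace σ' (c t) → σ = σ' ∘ π →
      Function.Injective (Fin.cons v σ : Fin (m + 3) → V) →
      Finset.image (Fin.cons v σ : Fin (m + 3) → V) Finset.univ = t →
      g (Fin.cons v σ) = ((Equiv.Perm.sign π : ℤ) : ℝ) := by
    intro t ht σ σ' v π hind hπ hinj him
    obtain ⟨i, himi, hi⟩ := hind.exists_faceVal
    have himσ : Finset.image σ Finset.univ = t.erase (c t i) := by
      rw [hπ, image_comp_perm, himi, image_comp_succAbove (hc t ht).1, (hc t ht).2]
    have hv : c t i = v := by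
      have h1 : c t i ∈ Finset.image (Fin.cons v σ : Fin (m + 3) → V) Finset.univ := by
        rw [him]
        exact (hc t ht).2.subset (Finset.mem_image_of_mem _ (Finset.mem_univ i))
      rw [image_cons, himσ] at h1
      simpa using h1
    have h2 : g (Fin.cons v σ') = 1 := by
      have := hi (fun ρ => g (Fin.cons v ρ)) fun ρ π => hg.isAlt.cons_perm v ρ π
      rw [this, faceVal, ← hv, hg.isAlt.cons_face, ← mul_assoc, neg_one_pow_mul_self, one_mul,
        hgc t ht]
    rw [hπ, hg.isAlt.cons_perm, h2, mul_one]
  have hconst : ∀ (σ : Fin (m + 2) → V) (v v' : V), X.IsCellT (Fin.cons v σ : Fin (m + 3) → V) →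
      X.IsCellT (Fin.cons v' σ : Fin (m + 3) → V) →
      g (Fin.cons v σ) = g (Fin.cons v' σ) := by
    intro σ v v' hv hv'
    rcases eq_or_ne v v' with rfl | hne
    · rfl
    set t := Finset.image (Fin.cons v σ : Fin (m + 3) → V) Finset.univ with ht_def
    set t' := Finset.image (Fin.cons v' σ : Fin (m + 3) → V) Finset.univ with ht'_def
    have hσcard := card_image_tuple hv.tail.1
    have hst : Finset.image σ Finset.univ ⊆ t := by
      rw [ht_def, image_cons]; exact Finset.subset_insert _ _
    have hst' : Finset.image σ Finset.univ ⊆ t' := by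
      rw [ht'_def, image_cons]; exact Finset.subset_insert _ _
    by_cases ht : t ∈ X.componentCells m σ₀
    · have ht' := mem_componentCells_of_face hσ₀ ht hv'.2 (card_image_tuple hv'.1) hσcard hst hst'
      have hvσ : v ∉ Finset.image σ Finset.univ := by
        simpa using (Fin.cons_injective_iff.1 hv.1).1
      have hv't : v ∉ t' := by
        rw [ht'_def, image_cons, Finset.mem_insert]
        exact fun h => h.elim hne hvσ
      have hinter : t ∩ t' = Finset.image σ Finset.univ := by
        rw [ht_def, image_cons, Finset.insert_inter_of_notMem hv't,
          Finset.inter_eq_left.2 hst']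
      have htt' : t ≠ t' := fun h => hv't (h ▸ by rw [ht_def, image_cons]; simp)
      obtain ⟨σ', hinj', him', hf, hf'⟩ := hface t ht t' ht' htt' (hinter ▸ hσcard)
      obtain ⟨π, hπ⟩ := exists_perm_of_image_eq hv.tail.1 (him'.trans hinter)
      rw [hval t ht σ σ' v π hf hπ hv.1 rfl, hval t' ht' σ σ' v' π hf' hπ hv'.1 rfl]
    · have ht' : t' ∉ X.componentCells m σ₀ := fun ht' =>
        ht (mem_componentCells_of_face hσ₀ ht' hv.2 (card_image_tuple hv.1) hσcard hst' hst)
      have h1 : g (Fin.cons v σ) = 0 := if_neg ht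
      have h2 : g (Fin.cons v' σ) = 0 := if_neg ht'
      rw [h1, h2]
  refine ⟨g, hg, ?_, fun τ => ?_⟩
  · obtain ⟨t, htc, hcard, hsub⟩ := huni _ hσ₀.2
    exact ⟨c t, by rw [hgc t ⟨htc, hcard, σ₀, .refl _, hsub⟩]; exact one_ne_zero⟩
  · by_cases hτ : X.IsCellT τ
    · rw [cobdry, if_pos hτ]
      have hi : ∀ i, faceVal (X.degScale (X.bdry g)) τ i = g τ := fun i => by
        have hcell : X.IsCellT (Fin.cons (τ i) (τ ∘ i.succAbove) : Fin (m + 3) → V) := by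
          rw [cons_comp_succAbove, isCellT_comp_perm]
          exact hτ
        have hb : X.bdry g (τ ∘ i.succAbove) =
            X.degT (τ ∘ i.succAbove) * g (Fin.cons (τ i) (τ ∘ i.succAbove)) := by
          rw [bdry_apply, ← sum_isCellT_cons hcell.tail.1, Finset.sum_mul]
          refine Finset.sum_congr rfl fun v _ => ?_
          split_ifs with hv
          · rw [one_mul, hconst _ _ _ hv hcell]
          · simp
        have hd : (X.degT (τ ∘ i.succAbove) : ℝ) ≠ 0 := by
          exact_mod_cast (hdeg _ hcell.tail).ne'
        rw [faceVal, degScale, hb, mul_div_cancel_left₀ _ hd, hg.isAlt.cons_face, ← mul_assoc,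
          neg_one_pow_mul_self, one_mul]
      simp only [hi, Finset.sum_const, Finset.card_univ, Fintype.card_fin, nsmul_eq_mul]
      push_cast
      ring
    · rw [hg.1 τ hτ, mul_zero]
      exact if_neg hτ

end Disorientation

end SComplex

namespace SComplex

section Walk

variable {V : Type*} {X : SComplex V} [Fintype V]

/-- The normalized transition operator `1 - (2 / (d + 1)) Δ⁺` of the critical lazy walk. -/
def stepₗ (X : SComplex V) (m : ℕ) : X.forms (m + 2) →ₗ[ℝ] X.forms (m + 2) :=
  LinearMap.id - (2 / ((m : ℝ) + 3)) • (X.bdryₗ (m + 1) ∘ₗ X.cobdryₗ (m + 2))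

lemma stepₗ_apply {m : ℕ} (f : X.forms (m + 2)) :
    X.stepₗ m f = f - (2 / ((m : ℝ) + 3)) • X.bdryₗ (m + 1) (X.cobdryₗ (m + 2) f) := rfl

lemma innerWₗ_bdry {n : ℕ} (f : X.forms (n + 1)) (g : X.forms (n + 2)) :
    X.innerWₗ (n + 1) f (X.bdryₗ n g) = X.innerUₗ (n + 2) (X.cobdryₗ (n + 1) f) g :=
  innerW_bdry f.1 g.2

lemma innerWₗ_comm {n : ℕ} (f g : X.forms n) : X.innerWₗ n f g = X.innerWₗ n g f :=
  innerW_comm f.1 g.1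

lemma innerWₗ_bdry_cobdry {n : ℕ} (f g : X.forms (n + 1)) :
    X.innerWₗ (n + 1) (X.bdryₗ n (X.cobdryₗ (n + 1) f)) g =
      X.innerUₗ (n + 2) (X.cobdryₗ (n + 1) f) (X.cobdryₗ (n + 1) g) := by
  rw [innerWₗ_comm, innerWₗ_bdry]
  exact innerU_comm _ _

lemma innerWₗ_step {m : ℕ} (f g : X.forms (m + 2)) :
    X.innerWₗ (m + 2) (X.stepₗ m f) g = X.innerWₗ (m + 2) f g -
      (2 / ((m : ℝ) + 3)) *
        X.innerUₗ (m + 3) (X.cobdryₗ (m + 2) f) (X.cobdryₗ (m + 2) g) := by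
  rw [stepₗ_apply, map_sub, map_smul, LinearMap.sub_apply, LinearMap.smul_apply,
    innerWₗ_bdry_cobdry, smul_eq_mul]

lemma innerWₗ_step_comm {m : ℕ} (f g : X.forms (m + 2)) :
    X.innerWₗ (m + 2) (X.stepₗ m f) g = X.innerWₗ (m + 2) f (X.stepₗ m g) := by
  rw [innerWₗ_comm f, innerWₗ_step, innerWₗ_step, innerWₗ_comm g]
  congr 2
  exact innerU_comm _ _

lemma innerWₗ_step_pow_comm {m : ℕ} (k : ℕ) (f g : X.forms (m + 2)) :
    X.innerWₗ (m + 2) ((X.stepₗ m ^ k) f) g = X.innerWₗ (m + 2) f ((X.stepₗ m ^ k) g) := by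
  induction k generalizing f with
  | zero => simp
  | succ k ih =>
    rw [pow_succ, Module.End.mul_apply, ih, innerWₗ_step_comm, ← Module.End.mul_apply,
      ← pow_succ', pow_succ]

lemma nexp_eq_step_pow {m : ℕ} (hdeg : ∀ σ : Fin (m + 2) → V, X.IsCellT σ → 0 < X.degT σ)
    {p : ℝ} (hp : p = ((m + 2 : ℝ) - 1) / (3 * (m + 2 : ℝ) - 1)) {σ : Fin (m + 2) → V}
    (hσ : X.IsCellT σ) (k : ℕ) :
    X.nexp p σ k = ((X.stepₗ m ^ k) ⟨dirac σ, isForm_dirac hσ⟩).1 := by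
  have h5 : (3 * (m + 2 : ℝ) - 1) = 3 * m + 5 := by ring
  have hpos : (0 : ℝ) < 3 * m + 5 := by positivity
  have hpos3 : (0 : ℝ) < m + 3 := by positivity
  have hpos2 : (0 : ℝ) < m + 2 := by positivity
  have hc : ((m + 1 : ℕ) + 1 : ℝ) / (p * ((m + 1 : ℕ) : ℝ) + 1) = (3 * m + 5) / (m + 3) := by
    have h1 : p * ((m + 1 : ℕ) : ℝ) + 1 = (m + 2) * (m + 3) / (3 * m + 5) := by
      rw [hp, h5]
      push_cast
      field_simp
      ring
    rw [h1]
    push_cast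
    field_simp
    ring
  have hstep : ∀ (f : X.forms (m + 2)) (a : ℝ), ((3 * m + 5 : ℝ) / (m + 3)) •
      X.transOp p (a • f.1) = a • (X.stepₗ m f).1 := by
    intro f a
    funext ρ
    have hn := nbrW_eq (n := m + 1) hdeg (X.forms (m + 2) |>.smul_mem a f.2) ρ
    have hΔ : X.bdry (X.cobdry (a • f.1)) ρ = a * X.bdry (X.cobdry f.1) ρ :=
      congrFun (congrArg Subtype.val
        ((X.bdryₗ (m + 1) ∘ₗ X.cobdryₗ (m + 2)).map_smul a f)) ρ
    have hs : (X.stepₗ m f).1 ρ = f.1 ρ - 2 / ((m : ℝ) + 3) * X.bdry (X.cobdry f.1) ρ := rfl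
    simp only [Pi.smul_apply, smul_eq_mul, transOp] at hn ⊢
    rw [hn, hΔ, hs, hp, h5]
    push_cast
    field_simp
    ring
  rw [nexp, hc]
  suffices h : ∀ k, (((3 * m + 5 : ℝ) / (m + 3)) ^ k) • (X.transOp p)^[k] (dirac σ) =
      ((X.stepₗ m ^ k) ⟨dirac σ, isForm_dirac hσ⟩).1 from h k
  intro k
  induction k with
  | zero => simp
  | succ k ih =>
    have hne : ((3 * m + 5 : ℝ) / (m + 3)) ^ k ≠ 0 := by positivity
    have ih' : (X.transOp p)^[k] (dirac σ) = (((3 * m + 5 : ℝ) / (m + 3)) ^ k)⁻¹ •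
        ((X.stepₗ m ^ k) ⟨dirac σ, isForm_dirac hσ⟩).1 := by
      rw [← ih, smul_smul, inv_mul_cancel₀ hne, one_smul]
    rw [Function.iterate_succ_apply', ih', pow_succ, mul_smul, hstep, smul_smul,
      mul_inv_cancel₀ hne, one_smul, pow_succ', Module.End.mul_apply]

lemma degT_pos {m : ℕ} (huni : ∀ s ∈ X.cells, ∃ t ∈ X.cells, t.card = m + 3 ∧ s ⊆ t)
    (σ : Fin (m + 2) → V) (hσ : X.IsCellT σ) : 0 < X.degT σ := by
  obtain ⟨t, ht, hcard, hsub⟩ := huni _ hσ.2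
  rw [degT, degS, Set.ncard_pos (Set.toFinite _)]
  exact ⟨t, ht, by rw [hcard, card_image_tuple hσ.1], hsub⟩

lemma innerUₗ_cobdry_le {m : ℕ} (f : X.forms (m + 2)) :
    X.innerUₗ (m + 3) (X.cobdryₗ (m + 2) f) (X.cobdryₗ (m + 2) f) ≤
      ((m : ℝ) + 3) * X.innerWₗ (m + 2) f f := by
  have := energy_le f.2
  push_cast at this
  rw [show (m : ℝ) + 2 + 1 = m + 3 by ring] at this
  exact this

lemma exists_hasDisorientation_of_energy_eq {m : ℕ}
    (hdeg : ∀ σ : Fin (m + 2) → V, X.IsCellT σ → 0 < X.degT σ) {f : X.forms (m + 2)}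
    (hf : f ≠ 0) (he : X.innerUₗ (m + 3) (X.cobdryₗ (m + 2) f) (X.cobdryₗ (m + 2) f) =
      ((m : ℝ) + 3) * X.innerWₗ (m + 2) f f) :
    ∃ σ₀ : Fin (m + 2) → V, X.IsCellT σ₀ ∧ HasDisorientation m (X.componentCells m σ₀) := by
  obtain ⟨σ₀, hσ₀⟩ : ∃ σ, f.1 σ ≠ 0 := by
    by_contra! h
    exact hf (Subtype.ext (funext h))
  have hc : X.IsCellT σ₀ := by
    by_contra h
    exact hσ₀ (f.2.1 σ₀ h)
  have hd : (X.degT σ₀ : ℝ) ≠ 0 := by exact_mod_cast (hdeg σ₀ hc).ne'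
  have he' : innerU (X.cobdry f.1) (X.cobdry f.1) =
      (((m + 2 : ℕ) : ℝ) + 1) * X.innerW f.1 f.1 := by
    push_cast
    rw [show (m : ℝ) + 2 + 1 = m + 3 by ring]
    exact he
  refine ⟨σ₀, hc, hasDisorientation_of_faceVal (IsForm.degScale f.2).isAlt
    (S := (((m + 2 : ℕ) : ℝ) + 1)⁻¹ • X.cobdry f.1) (fun τ hτ i => ?_)
    (IsForm.isAlt (X := X) ((X.forms (m + 3)).smul_mem _ (IsForm.cobdry f.2))) hc (div_ne_zero hσ₀ hd)⟩
  rw [Pi.smul_apply, smul_eq_mul, ← faceVal_of_energy_eq f.2 he' hτ i]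
  field_simp

/-- A fixed form of the walk is orthogonal to the boundaries. -/
lemma innerWₗ_bdry_eq_zero_of_fixed {m : ℕ} {L : X.forms (m + 2)} (hL : X.stepₗ m L = L)
    (g : X.forms (m + 3)) : X.innerWₗ (m + 2) L (X.bdryₗ (m + 1) g) = 0 := by
  have h1 := innerWₗ_step L L
  rw [hL] at h1
  have h2 : X.innerUₗ (m + 3) (X.cobdryₗ (m + 2) L) (X.cobdryₗ (m + 2) L) = 0 := by
    have : (2 / ((m : ℝ) + 3)) ≠ 0 := by positivity
    exact (mul_eq_zero.1 (by linarith)).resolve_left this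
  have h3 : X.cobdryₗ (m + 2) L = 0 := by
    by_contra h
    exact (innerUₗ_self_pos _ h).ne' h2
  rw [innerWₗ_bdry, h3]
  simp

/-- The walk started at a form moves it only by boundaries. -/
lemma step_pow_sub_mem_range {m : ℕ} (f : X.forms (m + 2)) (k : ℕ) :
    (X.stepₗ m ^ k) f - f ∈ LinearMap.range (X.bdryₗ (m + 1)) := by
  induction k with
  | zero => simp
  | succ k ih =>
    rw [pow_succ', Module.End.mul_apply, stepₗ_apply, sub_right_comm]
    exact Submodule.sub_mem _ ih (Submodule.smul_mem _ _ (LinearMap.mem_range_self _ _))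

lemma tendsto_innerW {n : ℕ} {F : ℕ → (Fin n → V) → ℝ} {L : (Fin n → V) → ℝ}
    (hF : Tendsto F atTop (𝓝 L)) (h : (Fin n → V) → ℝ) :
    Tendsto (fun k => X.innerW (F k) h) atTop (𝓝 (X.innerW L h)) := by
  have hcont : Continuous fun f : (Fin n → V) → ℝ => X.innerW f h := by
    unfold innerW
    fun_prop
  exact (hcont.tendsto L).comp hF

lemma innerW_nexp {m : ℕ} (hdeg : ∀ σ : Fin (m + 2) → V, X.IsCellT σ → 0 < X.degT σ)
    {p : ℝ} (hp : p = ((m + 2 : ℝ) - 1) / (3 * (m + 2 : ℝ) - 1)) {σ : Fin (m + 2) → V}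
    (hσ : X.IsCellT σ) (k : ℕ) (f : X.forms (m + 2)) :
    X.innerW (X.nexp p σ k) f.1 = ((X.stepₗ m ^ k) f).1 σ / X.degT σ := by
  rw [nexp_eq_step_pow hdeg hp hσ]
  refine (innerWₗ_step_pow_comm k ⟨dirac σ, isForm_dirac hσ⟩ f).trans ?_
  exact innerW_dirac hσ.1 (IsForm.isAlt ((X.stepₗ m ^ k) f).2)

lemma exists_bdry_eq_of_tendsto {m : ℕ}
    (hdeg : ∀ σ : Fin (m + 2) → V, X.IsCellT σ → 0 < X.degT σ)
    {p : ℝ} (hp : p = ((m + 2 : ℝ) - 1) / (3 * (m + 2 : ℝ) - 1))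
    (hlim : ∀ σ : Fin (m + 2) → V, X.IsCellT σ →
      ∃ L, Tendsto (fun nn => X.nexp p σ nn) atTop (𝓝 L) ∧ X.IsExactForm m L)
    (f : X.forms (m + 2)) (hf : X.bdry f.1 = 0) :
    ∃ g : X.forms (m + 3), X.bdryₗ (m + 1) g = f := by
  have hzero : Tendsto (fun k => ((X.stepₗ m ^ k) f).1) atTop (𝓝 0) := by
    rw [tendsto_pi_nhds]
    intro σ
    by_cases hσ : X.IsCellT σ
    · obtain ⟨L, hL, -, g, -, hg⟩ := hlim σ hσ
      have h1 := tendsto_innerW (X := X) hL f.1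
      rw [hg f.1 f.2, hf] at h1
      have h2 : innerU g (0 : (Fin (m + 1) → V) → ℝ) = 0 := by simp [innerU]
      rw [h2] at h1
      simp_rw [innerW_nexp hdeg hp hσ] at h1
      have hd : (X.degT σ : ℝ) ≠ 0 := by exact_mod_cast (hdeg σ hσ).ne'
      simpa [div_mul_cancel₀ _ hd] using h1.mul_const (X.degT σ : ℝ)
    · have : ∀ k, ((X.stepₗ m ^ k) f).1 σ = 0 := fun k => ((X.stepₗ m ^ k) f).2.1 σ hσ
      simp [this]
  let R : Submodule ℝ ((Fin (m + 2) → V) → ℝ) :=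
    (LinearMap.range (X.bdryₗ (m + 1))).map (X.forms (m + 2)).subtype
  have hmem : (0 : (Fin (m + 2) → V) → ℝ) - f.1 ∈ R :=
    R.closed_of_finiteDimensional.mem_of_tendsto (hzero.sub_const f.1)
      (.of_forall fun k => ⟨_, step_pow_sub_mem_range f k, rfl⟩)
  rw [zero_sub, Submodule.neg_mem_iff] at hmem
  obtain ⟨_, ⟨g, rfl⟩, hg⟩ := hmem
  exact ⟨g, Subtype.ext hg⟩

lemma not_hasDisorientation_of_tendsto {m : ℕ}
    (huni : ∀ s ∈ X.cells, ∃ t ∈ X.cells, t.card = m + 3 ∧ s ⊆ t)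
    {p : ℝ} (hp : p = ((m + 2 : ℝ) - 1) / (3 * (m + 2 : ℝ) - 1))
    (hlim : ∀ σ : Fin (m + 2) → V, X.IsCellT σ →
      ∃ L, Tendsto (fun nn => X.nexp p σ nn) atTop (𝓝 L))
    {σ₀ : Fin (m + 2) → V} (hσ₀ : X.IsCellT σ₀) :
    ¬ HasDisorientation m (X.componentCells m σ₀) := by
  intro hdis
  have hdeg := degT_pos huni
  obtain ⟨g, hg, ⟨τ, hτ⟩, hgΔ⟩ := exists_form_of_hasDisorientation huni hdeg hσ₀ hdis
  let f := X.bdryₗ (m + 1) ⟨g, hg⟩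
  have hδ : X.cobdryₗ (m + 2) f = ((m : ℝ) + 3) • ⟨g, hg⟩ := Subtype.ext (funext hgΔ)
  have hstep : X.stepₗ m f = -f := by
    rw [stepₗ_apply, hδ, map_smul, smul_smul, div_mul_cancel₀ _ (by positivity), two_smul]
    exact sub_add_cancel_left f f
  have hpow : ∀ k, (X.stepₗ m ^ k) f = (-1 : ℝ) ^ k • f := fun k => by
    induction k with
    | zero => simp
    | succ k ih =>
      rw [pow_succ', Module.End.mul_apply, ih, map_smul, hstep, pow_succ, mul_neg_one]
      exact (smul_neg _ _).trans (neg_smul _ _).symm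
  obtain ⟨σ, hσ⟩ : ∃ σ, f.1 σ ≠ 0 := by
    by_contra! h
    have h0 : f = 0 := Subtype.ext (funext h)
    rw [h0, map_zero] at hδ
    have := congrFun (congrArg Subtype.val hδ) τ
    simp only [ZeroMemClass.coe_zero, Pi.zero_apply, Submodule.coe_smul, Pi.smul_apply,
      smul_eq_mul, zero_eq_mul] at this
    exact this.elim (by positivity) hτ
  have hc : X.IsCellT σ := by
    by_contra h
    exact hσ (f.2.1 σ h)
  obtain ⟨L, hL⟩ := hlim σ hc
  have h1 := tendsto_innerW (X := X) hL f.1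
  simp_rw [innerW_nexp hdeg hp hc, hpow] at h1
  have h2 := (h1.comp (tendsto_add_atTop_nat 1)).add h1
  have h3 : X.innerW L f.1 = 0 := by
    have := tendsto_nhds_unique (h2.congr' (.of_forall fun k => ?_)) tendsto_const_nhds (b := 0)
    · linarith
    · simp [pow_succ, neg_div]
  have h4 := h1.abs
  rw [h3] at h4
  simp only [Submodule.coe_smul, Pi.smul_apply, smul_eq_mul, abs_div, abs_mul, abs_pow, abs_neg,
    abs_one, one_pow, one_mul, abs_zero] at h4
  have h5 := tendsto_nhds_unique h4 tendsto_const_nhds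
  have hd : (X.degT σ : ℝ) ≠ 0 := by exact_mod_cast (hdeg σ hc).ne'
  exact div_ne_zero (abs_ne_zero.2 hσ) (abs_ne_zero.2 hd) h5.symm

lemma tendsto_exact_of_not_hasDisorientation {m : ℕ}
    (hdeg : ∀ σ : Fin (m + 2) → V, X.IsCellT σ → 0 < X.degT σ)
    {p : ℝ} (hp : p = ((m + 2 : ℝ) - 1) / (3 * (m + 2 : ℝ) - 1))
    (hhom : ∀ f : (Fin (m + 2) → V) → ℝ, X.IsForm (m + 2) f → X.bdry f = 0 →
      ∃ g : (Fin (m + 3) → V) → ℝ, X.IsForm (m + 3) g ∧ X.bdry g = f)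
    (hdis : ∀ σ₀ : Fin (m + 2) → V, X.IsCellT σ₀ →
      ¬ HasDisorientation m (X.componentCells m σ₀))
    {σ : Fin (m + 2) → V} (hσ : X.IsCellT σ) :
    ∃ L, Tendsto (fun nn => X.nexp p σ nn) atTop (𝓝 L) ∧ X.IsExactForm m L := by
  have hm : (0 : ℝ) < m + 3 := by positivity
  obtain ⟨L, hL, hlim⟩ := exists_fixed_tendsto_pow (X.innerWₗ (m + 2)) innerWₗ_comm
    (innerWₗ_self_pos hdeg) (X.stepₗ m) innerWₗ_step_comm
    (fun f => by
      rw [innerWₗ_step]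
      have := innerU_self_nonneg (X.cobdryₗ (m + 2) f).1
      rw [← innerUₗ_apply] at this
      have : 0 ≤ 2 / ((m : ℝ) + 3) *
        X.innerUₗ (m + 3) (X.cobdryₗ (m + 2) f) (X.cobdryₗ (m + 2) f) := by positivity
      linarith)
    (fun f hf => by
      have hne : X.innerUₗ (m + 3) (X.cobdryₗ (m + 2) f) (X.cobdryₗ (m + 2) f) ≠
          ((m : ℝ) + 3) * X.innerWₗ (m + 2) f f := fun he => by
        obtain ⟨σ₀, hσ₀, h⟩ := exists_hasDisorientation_of_energy_eq hdeg hf he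
        exact hdis σ₀ hσ₀ h
      have hlt := lt_of_le_of_ne (innerUₗ_cobdry_le f) hne
      rw [innerWₗ_step]
      have : 2 / ((m : ℝ) + 3) *
          X.innerUₗ (m + 3) (X.cobdryₗ (m + 2) f) (X.cobdryₗ (m + 2) f) <
          2 * X.innerWₗ (m + 2) f f := by
        rw [div_mul_eq_mul_div, div_lt_iff₀ hm]
        linarith
      linarith)
    ⟨dirac σ, isForm_dirac hσ⟩
  refine ⟨L.1, ?_, L.2, ?_⟩
  · rw [tendsto_pi_nhds]
    intro ρ
    simp_rw [nexp_eq_step_pow hdeg hp hσ]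
    exact hlim (LinearMap.proj ρ ∘ₗ (X.forms (m + 2)).subtype)
  · obtain ⟨g, hg⟩ := exists_repr_of_ker_le (X.innerUₗ (m + 1)) innerUₗ_self_pos (X.bdryₗ m)
      (X.innerWₗ (m + 2) L) (fun h hh => by
        obtain ⟨g, hg, hgh⟩ := hhom h.1 h.2 (congrArg Subtype.val hh)
        have : h = X.bdryₗ (m + 1) ⟨g, hg⟩ := Subtype.ext hgh.symm
        rw [this]
        exact innerWₗ_bdry_eq_zero_of_fixed hL _)
    exact ⟨g.1, g.2, fun h hh => hg ⟨h, hh⟩⟩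

end Walk

end SComplex

/-- For a finite uniform `d`-dimensional complex (`d = m+2 ≥ 2`) and
`p = (d-1)/(3d-1)`, the normalized expectation process converges to an exact limit
from every starting cell iff `H_{d-1}(X;ℝ) = 0` and no `(d-1)`-component of `X` is
disorientable. -/
theorem stmt3 {V : Type*} [Fintype V] (m : ℕ) (X : SComplex V)
    (hdim : ∀ s ∈ X.cells, s.card ≤ m + 3)
    (huni : ∀ s ∈ X.cells, ∃ t ∈ X.cells, t.card = m + 3 ∧ s ⊆ t)
    (htop : ∃ s ∈ X.cells, s.card = m + 3)
    (p : ℝ) (hp : p = ((m + 2 : ℝ) - 1) / (3 * (m + 2 : ℝ) - 1)) :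
    (∀ σ₀ : Fin (m + 2) → V, X.IsCellT σ₀ →
        ∃ L, Tendsto (fun nn => X.nexp p σ₀ nn) atTop (𝓝 L) ∧ X.IsExactForm m L) ↔
      ((∀ f : (Fin (m + 2) → V) → ℝ, X.IsForm (m + 2) f → X.bdry f = 0 →
          ∃ g : (Fin (m + 3) → V) → ℝ, X.IsForm (m + 3) g ∧ X.bdry g = f) ∧
        ∀ σ₀ : Fin (m + 2) → V, X.IsCellT σ₀ →
          ¬ HasDisorientation m
              {t : Finset V | t ∈ X.cells ∧ t.card = m + 3 ∧
                ∃ σ : Fin (m + 2) → V, Relation.EqvGen X.Nbr σ₀ σ ∧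
                  Finset.image σ Finset.univ ⊆ t}) := by
  have hdeg := degT_pos huni
  constructor
  · intro hlim
    refine ⟨fun f hf hf0 => ?_, fun σ₀ hσ₀ => not_hasDisorientation_of_tendsto huni hp
      (fun σ hσ => (hlim σ hσ).imp fun _ h => h.1) hσ₀⟩
    obtain ⟨g, hg⟩ := exists_bdry_eq_of_tendsto hdeg hp hlim ⟨f, hf⟩ hf0
    exact ⟨g.1, g.2, congrArg Subtype.val hg⟩
  · rintro ⟨hhom, hdis⟩ σ₀ hσ₀
    exact tendsto_exact_of_not_hasDisorientation hdeg hp hhom hdis hσ₀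

end
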